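/- arXiv:2010.13159 — 2 statements merged into one kernel-verified Lean document; each statement's English description precedes it below -/
import Mathlib

section
/- Let 𝔭' be the set of 6×6 complex matrices of the form [[0, conj(D)],[D, 0]] (blocks of size 3) with D = [[0, d],[dᵀ, 0]] for some complex column vector d of length 2 (blocks of size 2 and 1). Then the ℝ-linear span of the set of commutators {XY − YX : X, Y ∈ 𝔭'} equals the set of 6×6 matrices of the form [[C, 0],[0, conj(C)]] with C = [[F, 0],[0, tr(F)]] for some skew-Hermitian 2×2 complex matrix F. -/
open Matrix

/-- An element of `𝔭'` for family (8): the `6×6` matrix `[[0, conj D],[D, 0]]` with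
`D = [[0, d],[dᵀ, 0]]` for a vector `d ∈ ℂ²`. -/
def pElem8 (d : Fin 2 → ℂ) :
    Matrix ((Fin 2 ⊕ Fin 1) ⊕ (Fin 2 ⊕ Fin 1)) ((Fin 2 ⊕ Fin 1) ⊕ (Fin 2 ⊕ Fin 1)) ℂ :=
  Matrix.fromBlocks 0
    ((Matrix.fromBlocks 0 (Matrix.of fun i (_ : Fin 1) => d i)
        (Matrix.of fun (_ : Fin 1) j => d j) 0).map (starRingEnd ℂ))
    (Matrix.fromBlocks 0 (Matrix.of fun i (_ : Fin 1) => d i)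
        (Matrix.of fun (_ : Fin 1) j => d j) 0) 0

/-- The real-linear map `F ↦ [[C, 0],[0, conj C]]` with `C = [[F, 0],[0, tr F]]`. -/
def kElem8 : Matrix (Fin 2) (Fin 2) ℂ →ₗ[ℝ]
    Matrix ((Fin 2 ⊕ Fin 1) ⊕ (Fin 2 ⊕ Fin 1)) ((Fin 2 ⊕ Fin 1) ⊕ (Fin 2 ⊕ Fin 1)) ℂ where
  toFun F := Matrix.fromBlocks
    (Matrix.fromBlocks F 0 0 (Matrix.of fun _ _ => F.trace)) 0 0
    ((Matrix.fromBlocks F 0 0 (Matrix.of fun _ _ => F.trace)).map (starRingEnd ℂ))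
  map_add' F G := by
    ext ((i | i) | (i | i)) ((j | j) | (j | j)) <;> simp
  map_smul' r F := by
    ext ((i | i) | (i | i)) ((j | j) | (j | j)) <;> simp

theorem pElem8_commutator (d e : Fin 2 → ℂ) :
    pElem8 d * pElem8 e - pElem8 e * pElem8 d =
      kElem8 (vecMulVec (star d) e - vecMulVec (star e) d) := by
  ext ((i | i) | (i | i)) ((j | j) | (j | j)) <;>
    simp [pElem8, kElem8, Matrix.mul_apply, vecMulVec_apply, Matrix.trace, Fin.sum_univ_two] <;>
    ring

theorem eq_sum_vecMulVec_sub_of_skewHermitian {n : Type*} [Fintype n] [DecidableEq n]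
    {F : Matrix n n ℂ} (hF : Fᴴ = -F) :
    F = ∑ k, (vecMulVec (star (Pi.single k 1)) ((1 / 2 : ℂ) • F k) -
      vecMulVec (star ((1 / 2 : ℂ) • F k)) (Pi.single k 1)) := by
  ext i j
  have h : star (F j i) = -F i j := congrFun (congrFun hF i) j
  simp [Matrix.sum_apply, vecMulVec_apply, Pi.single_apply] at h ⊢
  rw [h]
  ring

/-- family (8): the `ℝ`-linear span of the commutators of elements of
`𝔭'` equals the set of matrices `[[C, 0],[0, conj C]]` with `C = [[F, 0],[0, tr F]]`
for `F ∈ u(2)` skew-Hermitian.  (This is `𝔨' = [𝔭', 𝔭']`.) -/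
theorem stmt18 :
    (Submodule.span ℝ
        {Z : Matrix ((Fin 2 ⊕ Fin 1) ⊕ (Fin 2 ⊕ Fin 1)) ((Fin 2 ⊕ Fin 1) ⊕ (Fin 2 ⊕ Fin 1)) ℂ |
          ∃ d e : Fin 2 → ℂ, Z = pElem8 d * pElem8 e - pElem8 e * pElem8 d} :
      Set (Matrix ((Fin 2 ⊕ Fin 1) ⊕ (Fin 2 ⊕ Fin 1)) ((Fin 2 ⊕ Fin 1) ⊕ (Fin 2 ⊕ Fin 1)) ℂ)) =
    {Z | ∃ F : Matrix (Fin 2) (Fin 2) ℂ, (F.map (starRingEnd ℂ))ᵀ = -F ∧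
      Z = Matrix.fromBlocks
        (Matrix.fromBlocks F 0 0 (Matrix.of fun _ _ => F.trace)) 0 0
        ((Matrix.fromBlocks F 0 0 (Matrix.of fun _ _ => F.trace)).map (starRingEnd ℂ))} := by
  apply Set.Subset.antisymm
  · intro Z hZ
    induction hZ using Submodule.span_induction with
    | mem Z hZ =>
      obtain ⟨d, e, rfl⟩ := hZ
      refine ⟨_, ?_, pElem8_commutator d e⟩
      ext i j
      simp [vecMulVec_apply]
      ring
    | zero => exact ⟨0, by simp, (map_zero kElem8).symm⟩
    | add X Y _ _ hX hY =>
      obtain ⟨F, hF, rfl⟩ := hX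
      obtain ⟨G, hG, rfl⟩ := hY
      refine ⟨F + G, ?_, (map_add kElem8 F G).symm⟩
      rw [Matrix.map_add _ (map_add _), transpose_add, hF, hG, neg_add]
    | smul r X _ hX =>
      obtain ⟨F, hF, rfl⟩ := hX
      refine ⟨r • F, ?_, (map_smul kElem8 r F).symm⟩
      rw [← smul_neg, ← hF]
      ext i j
      simp
  · rintro _ ⟨F, hF, rfl⟩
    change kElem8 F ∈ Submodule.span ℝ _
    rw [eq_sum_vecMulVec_sub_of_skewHermitian (F := F) hF, map_sum]
    exact Submodule.sum_mem _ fun k _ =>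
      Submodule.subset_span ⟨_, _, (pElem8_commutator _ _).symm⟩
end

section
/- Consider the real-linear action of the set u(2) of skew-Hermitian 2×2 complex matrices on ℂ² given by F · d = conj(F)·d − tr(F)·d (conj = entrywise conjugation of the matrix F, applied to the vector d ∈ ℂ²). Then the only ℝ-linear subspaces W ⊆ ℂ² satisfying F · d ∈ W for all F ∈ u(2) and all d ∈ W are W = {0} and W = ℂ². -/
open Matrix

lemma rotate_mem_of_invariant {W : Submodule ℝ (Fin 2 → ℂ)}
    (hW : ∀ F : Matrix (Fin 2) (Fin 2) ℂ, (F.map (starRingEnd ℂ))ᵀ = -F →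
      ∀ d ∈ W, (F.map (starRingEnd ℂ)) *ᵥ d - F.trace • d ∈ W)
    {x y : ℂ} (h : ![x, y] ∈ W) : ![y, -x] ∈ W := by
  have key := hW !![0, 1; -1, 0] (by ext i j; fin_cases i <;> fin_cases j <;> simp) _ h
  convert key using 1
  ext i
  fin_cases i <;> simp [Fin.sum_univ_two, Matrix.trace]

lemma I_mul_fst_mem_of_invariant {W : Submodule ℝ (Fin 2 → ℂ)}
    (hW : ∀ F : Matrix (Fin 2) (Fin 2) ℂ, (F.map (starRingEnd ℂ))ᵀ = -F →
      ∀ d ∈ W, (F.map (starRingEnd ℂ)) *ᵥ d - F.trace • d ∈ W)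
    {x y : ℂ} (h : ![x, y] ∈ W) :
    ![Complex.I * x, 0] ∈ W := by
  have key := hW !![-(2 / 3) * Complex.I, 0; 0, (1 / 3) * Complex.I]
    (by ext i j; fin_cases i <;> fin_cases j <;> simp [Complex.conj_ofNat]) _ h
  convert key using 1
  ext i
  fin_cases i <;> simp [Fin.sum_univ_two, Matrix.trace, Complex.conj_ofNat] <;> ring

lemma eq_top_of_invariant_of_fst_ne_zero {W : Submodule ℝ (Fin 2 → ℂ)}
    (hW : ∀ F : Matrix (Fin 2) (Fin 2) ℂ, (F.map (starRingEnd ℂ))ᵀ = -F →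
      ∀ d ∈ W, (F.map (starRingEnd ℂ)) *ᵥ d - F.trace • d ∈ W)
    {x y : ℂ} (h : ![x, y] ∈ W) (hx : x ≠ 0) :
    W = ⊤ := by
  have hIx := I_mul_fst_mem_of_invariant hW h
  have hIIx := I_mul_fst_mem_of_invariant hW hIx
  have hfst (z : ℂ) : ![z, 0] ∈ W := by
    have key := W.add_mem (W.smul_mem (z / x).im hIx) (W.smul_mem (-(z / x).re) hIIx)
    convert key using 1
    have hz : z = ((z / x).re + (z / x).im * Complex.I) * x := by
      rw [Complex.re_add_im, div_mul_cancel₀ z hx]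
    ext i
    fin_cases i
    · simp only [Fin.zero_eta, cons_val_zero, Pi.add_apply, Pi.smul_apply, Complex.real_smul,
        Complex.ofReal_neg]
      linear_combination hz + (z / x).re * x * Complex.I_mul_I
    · simp
  refine W.eq_top_iff'.2 fun d => ?_
  have key := W.add_mem (hfst (d 0)) (rotate_mem_of_invariant hW (hfst (-d 1)))
  convert key using 1
  ext i
  fin_cases i <;> simp

/-- irreducibility of the adjoint representation for family (8):
under the action `F · d = conj(F)·d - tr(F)·d` of `u(2)` on `ℂ²`, the only invariant
`ℝ`-linear subspaces of `ℂ²` are `{0}` and `ℂ²`. -/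
theorem stmt19 (W : Submodule ℝ (Fin 2 → ℂ))
    (hW : ∀ F : Matrix (Fin 2) (Fin 2) ℂ, (F.map (starRingEnd ℂ))ᵀ = -F →
      ∀ d ∈ W, (F.map (starRingEnd ℂ)) *ᵥ d - F.trace • d ∈ W) :
    W = ⊥ ∨ W = ⊤ := by
  by_contra! hne
  obtain ⟨d, hd, hd0⟩ := W.ne_bot_iff.1 hne.1
  have hd' : ![d 0, d 1] ∈ W := by
    convert hd using 1
    ext i
    fin_cases i <;> rfl
  have h0 : d 0 = 0 := by
    by_contra h
    exact hne.2 (eq_top_of_invariant_of_fst_ne_zero hW hd' h)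
  have h1 : d 1 = 0 := by
    by_contra h
    exact hne.2 (eq_top_of_invariant_of_fst_ne_zero hW (rotate_mem_of_invariant hW hd') h)
  apply hd0
  ext i
  fin_cases i <;> simp [h0, h1]
end
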